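/- arXiv:1802.04481 — 2 statements merged into one kernel-verified Lean document; each statement's English description precedes it below -/
import Mathlib

section
/- Let m(n) denote the minimum, over all binary words of length n, of the total number of square occurrences, and let 𝓜 = lim m(n)/n. Then 0.5508 < 𝓜 ≤ 103/187 (Kucherov–Ochem–Rao). -/
/-- The set of square occurrences `(i, ℓ)` in the word `w`: `ℓ ≥ 1` and the
factor of length `ℓ` starting at (0-indexed) position `i` equals the factor of
length `ℓ` starting at position `i + ℓ`. -/
def squareOccs (w : List Bool) : Set (ℕ × ℕ) :=
  {p | 1 ≤ p.2 ∧ p.1 + 2 * p.2 ≤ w.length ∧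
    (w.drop p.1).take p.2 = (w.drop (p.1 + p.2)).take p.2}

/-- `minSquareOccs n` is the minimum, over binary words `w` of length `n`, of
the total number of square occurrences in `w`. -/
noncomputable def minSquareOccs (n : ℕ) : ℕ :=
  sInf {m : ℕ | ∃ w : List Bool, w.length = n ∧ (squareOccs w).ncard = m}

namespace SqDens

/-! ### Basic facts on square occurrences -/

lemma mem_squareOccs (w : List Bool) (i p : ℕ) :
    (i, p) ∈ squareOccs w ↔ 1 ≤ p ∧ i + 2 * p ≤ w.length ∧
      ∀ k < p, w[i + k]? = w[i + p + k]? := by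
  simp only [squareOccs, Set.mem_ofPred_eq]
  refine and_congr_right fun _ => and_congr_right fun _ => ?_
  constructor
  · intro h k hk
    have := congrArg (fun l : List Bool => l[k]?) h
    simpa [List.getElem?_take, hk, List.getElem?_drop] using this
  · intro h
    apply List.ext_getElem?
    intro k
    by_cases hk : k < p
    · simpa [List.getElem?_take, hk, List.getElem?_drop] using h k hk
    · simp [hk]

lemma squareOccs_finite (w : List Bool) : (squareOccs w).Finite := by
  apply Set.Finite.subset ((Set.finite_Iic w.length).prod (Set.finite_Iic w.length))
  rintro ⟨i, p⟩ ⟨h1, h2, -⟩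
  simp only [Set.mem_prod, Set.mem_Iic] at *
  omega

/-! ### The lower bound -/

/-- The first `p` letters of both lists exist and agree. -/
def pre : ℕ → List Bool → List Bool → Bool
  | 0, _, _ => true
  | p + 1, a :: s, b :: d => (a == b) && pre p s d
  | _ + 1, _, _ => false

lemma pre_iff (p : ℕ) (s d : List Bool) :
    pre p s d = true ↔ p ≤ s.length ∧ p ≤ d.length ∧ ∀ k < p, s[k]? = d[k]? := by
  induction p generalizing s d with
  | zero => simp [pre]
  | succ p ih =>
    cases s with
    | nil => simp [pre]
    | cons a s =>
      cases d with
      | nil => simp [pre]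
      | cons b d =>
        simp only [pre, Bool.and_eq_true, beq_iff_eq, ih, List.length_cons]
        constructor
        · rintro ⟨rfl, h1, h2, h3⟩
          refine ⟨by omega, by omega, ?_⟩
          intro k hk
          cases k with
          | zero => simp
          | succ k => simpa using h3 k (by omega)
        · rintro ⟨h1, h2, h3⟩
          refine ⟨by simpa using h3 0 (by omega), by omega, by omega, ?_⟩
          intro k hk
          simpa using h3 (k + 1) (by omega)

/-- A square of period `p` is visible at the beginning of `t`. -/
def sqPre (t : List Bool) (p : ℕ) : Bool := pre p t (t.drop p)

lemma sqPre_iff (t : List Bool) (p : ℕ) :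
    sqPre t p = true ↔ 2 * p ≤ t.length ∧ ∀ k < p, t[k]? = t[p + k]? := by
  simp only [sqPre, pre_iff, List.length_drop, List.getElem?_drop]
  constructor
  · rintro ⟨h1, h2, h3⟩; exact ⟨by omega, h3⟩
  · rintro ⟨h1, h3⟩; exact ⟨by omega, by omega, h3⟩

lemma sqPre_mono {t r : List Bool} (h : t <+: r) (p : ℕ) (hp : sqPre t p = true) :
    sqPre r p = true := by
  obtain ⟨s, rfl⟩ := h
  rw [sqPre_iff] at *
  obtain ⟨h1, h2⟩ := hp
  refine ⟨by simp; omega, fun k hk => ?_⟩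
  rw [List.getElem?_append_left (by omega), List.getElem?_append_left (by omega)]
  exact h2 k hk

/-- The periods which matter for the lower bound. -/
def periods : List ℕ := [1, 2, 3, 4, 5, 6, 7, 40, 138]

/-- Number of squares visible at the beginning of `t` with a period in `periods`. -/
def cnt (t : List Bool) : ℕ := periods.countP (sqPre t)

lemma cnt_mono {t r : List Bool} (h : t <+: r) : cnt t ≤ cnt r :=
  List.countP_mono_left fun p _ hp => sqPre_mono h p hp

lemma squareOccs_snoc (w : List Bool) (a : Bool) :
    (squareOccs w).ncard + cnt (a :: w.reverse) ≤ (squareOccs (w ++ [a])).ncard := by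
  classical
  set F : Finset ℕ := periods.toFinset.filter (fun p => sqPre (a :: w.reverse) p = true) with hF
  have hcard : F.card = cnt (a :: w.reverse) := by
    rw [hF, cnt, List.countP_eq_length_filter, ← List.toFinset_filter,
      List.toFinset_card_of_nodup]
    exact List.Nodup.filter _ (by decide)
  have hr : a :: w.reverse = (w ++ [a]).reverse := by simp
  set G : Finset (ℕ × ℕ) := F.image (fun p => (w.length + 1 - 2 * p, p)) with hG
  have hGcard : G.card = F.card := by
    apply Finset.card_image_of_injective
    intro x y hxy
    simpa using congrArg Prod.snd hxy
  have hsq : ∀ p ∈ F, 1 ≤ p ∧ 2 * p ≤ w.length + 1 ∧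
      ∀ k < p, (w ++ [a]).reverse[k]? = (w ++ [a]).reverse[p + k]? := by
    intro p hp
    rw [hF, Finset.mem_filter, hr, sqPre_iff] at hp
    obtain ⟨h1, h2, h3⟩ := hp
    refine ⟨?_, by simpa using h2, h3⟩
    have : ∀ q ∈ periods, 1 ≤ q := by decide
    exact this p (by simpa using h1)
  have hdisj : Disjoint (squareOccs w) (G : Set (ℕ × ℕ)) := by
    rw [Set.disjoint_left]
    rintro ⟨i, p⟩ ⟨h1, h2, -⟩ h3
    rw [hG, Finset.mem_coe, Finset.mem_image] at h3
    obtain ⟨q, hq, he⟩ := h3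
    have := hsq q hq
    simp only [Prod.mk.injEq] at he h1 h2
    omega
  have hsub : squareOccs w ∪ (G : Set (ℕ × ℕ)) ⊆ squareOccs (w ++ [a]) := by
    rintro ⟨i, p⟩ (h | h)
    · rw [mem_squareOccs] at *
      obtain ⟨h1, h2, h3⟩ := h
      refine ⟨h1, by simp; omega, fun k hk => ?_⟩
      rw [List.getElem?_append_left (by omega), List.getElem?_append_left (by omega)]
      exact h3 k hk
    · rw [hG, Finset.mem_coe, Finset.mem_image] at h
      obtain ⟨q, hq, he⟩ := h
      obtain ⟨h1, h2, h3⟩ := hsq q hq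
      simp only [Prod.mk.injEq] at he
      obtain ⟨he1, rfl⟩ := he
      rw [mem_squareOccs]
      refine ⟨h1, by simp; omega, fun k hk => ?_⟩
      have := h3 (q - 1 - k) (by omega)
      rw [List.getElem?_reverse (by simp; omega), List.getElem?_reverse (by simp; omega)] at this
      simp only [List.length_append, List.length_cons, List.length_nil] at this
      rw [show i + k = w.length + (0 + 1) - 1 - (q + (q - 1 - k)) by omega,
        show i + q + k = w.length + (0 + 1) - 1 - (q - 1 - k) by omega]
      exact this.symm
  calc (squareOccs w).ncard + cnt (a :: w.reverse)
      = (squareOccs w).ncard + (G : Set (ℕ × ℕ)).ncard := by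
        rw [Set.ncard_coe_finset, hGcard, hcard]
    _ = (squareOccs w ∪ (G : Set (ℕ × ℕ))).ncard :=
        (Set.ncard_union_eq hdisj (squareOccs_finite w) G.finite_toSet).symm
    _ ≤ _ := Set.ncard_le_ncard hsub (squareOccs_finite _)

/-- Evaluate the first argument before passing it on. -/
def force (n : ℕ) (F : ℕ → Bool) : Bool :=
  match n with
  | 0 => F 0
  | k + 1 => F (k + 1)

lemma force_eq (n : ℕ) (F : ℕ → Bool) : force n F = F n := by cases n <;> rfl

/-- Abbreviations keeping the table below readable. -/
abbrev tt : Bool := true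

/-- See `tt`. -/
abbrev ff : Bool := false

/-- The key contexts of the lower-bound certificate (latest letter first) together with the
value of the potential that is needed there. -/
def keys : List (List Bool × ℕ) := [
  ([], 487),
  ([ff], 384),
  ([tt], 384),
  ([ff, ff], 329),
  ([tt, ff], 281),
  ([ff, tt], 281),
  ([tt, tt], 329),
  ([ff, ff, ff], 291),
  ([tt, ff, ff], 226),
  ([ff, tt, ff], 178),
  ([tt, tt, ff], 272),
  ([ff, ff, tt], 272),
  ([tt, ff, tt], 178),
  ([ff, tt, tt], 226),
  ([tt, tt, tt], 291),
  ([tt, ff, ff, ff], 188),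
  ([ff, tt, ff, ff], 123),
  ([ff, ff, tt, ff], 262),
  ([tt, tt, ff, tt], 262),
  ([tt, ff, tt, tt], 123),
  ([ff, tt, tt, tt], 188),
  ([ff, tt, ff, ff, ff], 67),
  ([tt, ff, tt, ff, ff], 151),
  ([tt, ff, ff, tt, ff], 159),
  ([ff, ff, tt, tt, ff], 253),
  ([tt, ff, tt, tt, ff], 59),
  ([ff, tt, ff, ff, tt], 59),
  ([tt, tt, ff, ff, tt], 253),
  ([ff, tt, tt, ff, tt], 159),
  ([ff, tt, ff, tt, tt], 151),
  ([tt, ff, tt, tt, tt], 67),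
  ([ff, ff, tt, ff, ff, ff], 75),
  ([ff, ff, ff, tt, tt, ff], 280),
  ([tt, tt, tt, ff, ff, tt], 284),
  ([tt, tt, ff, tt, tt, tt], 75),
  ([ff, ff, ff, tt, tt, ff, ff], 273),
  ([tt, tt, ff, ff, tt, tt, ff], 189),
  ([ff, ff, tt, tt, ff, ff, tt], 189),
  ([tt, tt, tt, ff, ff, tt, tt], 273),
  ([tt, tt, ff, ff, ff, tt, tt, ff, ff], 207),
  ([ff, ff, tt, tt, tt, ff, ff, tt, tt], 207),
  ([ff, tt, tt, ff, ff, tt, ff, tt, tt, ff], 105),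
  ([tt, ff, ff, tt, tt, ff, tt, ff, ff, tt], 105),
  ([ff, tt, ff, ff, ff, tt, tt, ff, tt, ff, ff], 39),
  ([tt, tt, tt, ff, ff, tt, ff, tt, tt, ff, ff], 280),
  ([ff, tt, tt, ff, tt, ff, ff, tt, tt, ff, tt], 0),
  ([tt, ff, tt, tt, tt, ff, ff, tt, ff, tt, tt], 39),
  ([tt, ff, tt, tt, ff, ff, ff, tt, ff, tt, tt, ff, ff], 0),
  ([ff, tt, ff, ff, tt, tt, tt, ff, tt, ff, ff, tt, tt], 0),
  ([tt, tt, tt, ff, tt, ff, ff, tt, tt, ff, tt, ff, tt, tt, ff, ff, tt, ff, tt, tt, tt, ff, ff, tt, tt, ff, tt, ff, ff, tt, tt, tt, ff, ff, tt, ff, tt, tt, ff, ff, tt, tt, tt, ff, tt, ff, ff, tt, tt, ff, tt], 283),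
  ([ff, ff, tt, tt, ff, ff, tt, ff, tt, tt, tt, ff, ff, tt, tt, ff, tt, ff, ff, tt, tt, tt, ff, ff, tt, ff, tt, tt, ff, ff, tt, tt, tt, ff, tt, ff, ff, tt, tt, ff, tt, ff, tt, tt, ff, ff, tt, ff, tt, tt, tt, ff, ff, tt, tt, ff, tt, ff, ff], 187),
  ([tt, tt, ff, ff, tt, tt, ff, tt, ff, ff, ff, tt, tt, ff, ff, tt, ff, tt, tt, ff, ff, ff, tt, tt, ff, tt, ff, ff, tt, tt, ff, ff, ff, tt, ff, tt, tt, ff, ff, tt, ff, tt, ff, ff, tt, tt, ff, tt, ff, ff, ff, tt, tt, ff, ff, tt, ff, tt, tt], 187),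
  ([tt, ff, ff, tt, ff, tt, tt, ff, ff, tt, tt, tt, ff, tt, ff, ff, tt, tt, ff, tt, ff, tt, tt, ff, ff, tt, ff, tt, tt, tt, ff, ff, tt, tt, ff, tt, ff, ff, tt, tt, tt, ff, ff, tt, ff, tt, tt, ff, ff, tt, tt, tt, ff, tt, ff, ff, tt, tt, ff, tt, ff, tt, tt, ff, ff, tt, ff, tt, tt, tt, ff, ff, tt, tt, ff, tt, ff, ff], 0),
  ([ff, tt, tt, ff, tt, ff, ff, tt, tt, ff, ff, ff, tt, ff, tt, tt, ff, ff, tt, ff, tt, ff, ff, tt, tt, ff, tt, ff, ff, ff, tt, tt, ff, ff, tt, ff, tt, tt, ff, ff, ff, tt, tt, ff, tt, ff, ff, tt, tt, ff, ff, ff, tt, ff, tt, tt, ff, ff, tt, ff, tt, ff, ff, tt, tt, ff, tt, ff, ff, ff, tt, tt, ff, ff, tt, ff, tt, tt], 0)]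

/-- Is some key context visible in `x` whose needed value is at most `u`? -/
def hitKey (x : List Bool) (u : ℕ) : List (List Bool × ℕ) → Bool
  | [] => false
  | (k, v) :: l => (k.isPrefixOf x && Nat.ble v u) || hitKey x u l

lemma hitKey_spec (x : List Bool) (u : ℕ) (l : List (List Bool × ℕ)) (h : hitKey x u l = true) :
    ∃ k v, (k, v) ∈ l ∧ k <+: x ∧ v ≤ u := by
  induction l with
  | nil => simp [hitKey] at h
  | cons e l ih =>
    obtain ⟨k, v⟩ := e
    simp [hitKey] at h
    rcases h with ⟨h1, h2⟩ | h
    · exact ⟨k, v, by simp, h1, h2⟩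
    · obtain ⟨k', v', h1, h2⟩ := ih h
      exact ⟨k', v', by simp [h1], h2⟩

/-- Exhaustive exploration of the extensions of the context `t` with potential `v`, until a key
context is met. -/
def explore : ℕ → List Bool → ℕ → Bool
  | 0, _, _ => false
  | f + 1, t, v =>
    (force (v + 187 * cnt (true :: t)) fun u => Nat.ble 103 u && force (u - 103) fun u =>
      (hitKey (true :: t) u keys || explore f (true :: t) u)) &&
    (force (v + 187 * cnt (false :: t)) fun u => Nat.ble 103 u && force (u - 103) fun u =>
      (hitKey (false :: t) u keys || explore f (false :: t) u))

lemma explore_step {f : ℕ} {t : List Bool} {v : ℕ} (h : explore f t v = true) (a : Bool) :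
    103 ≤ v + 187 * cnt (a :: t) ∧
    ((∃ k v', (k, v') ∈ keys ∧ k <+: a :: t ∧ v' ≤ v + 187 * cnt (a :: t) - 103) ∨
      ∃ f', explore f' (a :: t) (v + 187 * cnt (a :: t) - 103) = true) := by
  cases f with
  | zero => simp [explore] at h
  | succ f =>
    simp only [explore, force_eq, Bool.and_eq_true, Bool.or_eq_true, Nat.ble_eq] at h
    have key : 103 ≤ v + 187 * cnt (a :: t) ∧
        (hitKey (a :: t) (v + 187 * cnt (a :: t) - 103) keys = true ∨
          explore f (a :: t) (v + 187 * cnt (a :: t) - 103) = true) := by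
      cases a
      · exact h.2
      · exact h.1
    refine ⟨key.1, key.2.imp (fun h => hitKey_spec _ _ _ h) (fun h => ⟨f, h⟩)⟩

set_option maxRecDepth 100000 in
lemma keys_ok : (keys.all fun e => explore 280 e.1 e.2) = true := by
  decide +kernel

lemma lower_invariant (w : List Bool) : ∃ f t v, explore f t v = true ∧ t <+: w.reverse ∧
    103 * w.length + v ≤ 187 * (squareOccs w).ncard + 487 := by
  induction w using List.reverseRecOn with
  | nil =>
    refine ⟨280, [], 487, ?_, by simp, by simp⟩
    exact List.all_eq_true.1 keys_ok ([], 487) (by simp [keys])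
  | append_singleton w a ih =>
    obtain ⟨f, t, v, h1, h2, h3⟩ := ih
    have hc := squareOccs_snoc w a
    have hp : a :: t <+: a :: w.reverse := by simpa using h2
    have hm := cnt_mono hp
    have hrev : (w ++ [a]).reverse = a :: w.reverse := by simp
    rw [hrev]
    obtain ⟨g1, g2⟩ := explore_step h1 a
    simp only [List.length_append, List.length_cons, List.length_nil]
    rcases g2 with ⟨k, v', e1, e2, e3⟩ | ⟨f', e⟩
    · refine ⟨280, k, v', List.all_eq_true.1 keys_ok (k, v') e1, e2.trans hp, by omega⟩
    · exact ⟨f', a :: t, _, e, hp, by omega⟩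

lemma lower_bound (w : List Bool) : 103 * w.length ≤ 187 * (squareOccs w).ncard + 487 := by
  obtain ⟨f, t, v, -, -, h⟩ := lower_invariant w
  omega

/-! ### Squares in images of square-free words under uniform morphisms -/

/-- The first `N` letters of `w` contain no square. -/
def SF {α : Type} (N : ℕ) (w : ℕ → α) : Prop :=
  ∀ i p, 1 ≤ p → i + 2 * p ≤ N → ¬ ∀ k < p, w (i + k) = w (i + p + k)

/-- The image of the word `w` under the `q`-uniform morphism `h`. -/
def img {α : Type} (q : ℕ) (h : Fin 3 → ℕ → α) (w : ℕ → Fin 3) (n : ℕ) : α :=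
  h (w (n / q)) (n % q)

lemma img_eq {α : Type} {q : ℕ} (h : Fin 3 → ℕ → α) (w : ℕ → Fin 3) (j r : ℕ) (hr : r < q) :
    img q h w (q * j + r) = h (w j) r := by
  have hq : 0 < q := by omega
  simp [img, Nat.mul_add_div hq, Nat.div_eq_of_lt hr, Nat.mod_eq_of_lt hr]

/-- Two consecutive blocks. -/
def pair {α : Type} (q : ℕ) (h : Fin 3 → ℕ → α) (b c : Fin 3) (n : ℕ) : α :=
  if n < q then h b n else h c (n - q)

lemma img_pair {α : Type} {q : ℕ} (h : Fin 3 → ℕ → α) (w : ℕ → Fin 3) (j r : ℕ)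
    (hr : r < 2 * q) : img q h w (q * j + r) = pair q h (w j) (w (j + 1)) r := by
  unfold pair
  split_ifs with h1
  · exact img_eq h w j r h1
  · rw [show q * j + r = q * (j + 1) + (r - q) by rw [mul_add]; omega]
    exact img_eq h w (j + 1) (r - q) (by omega)

lemma long_square {α : Type} (q l ρ : ℕ) (h : Fin 3 → ℕ → α) (lam mu : Fin 3 → Fin 3 → ℕ)
    (hq : ρ + l ≤ q) (hl : 1 ≤ l)
    (hS : ∀ a b c k, k < q → (∀ t < l, h a (ρ + t) = pair q h b c (k + t)) → k = ρ)
    (hlam : ∀ a b, a ≠ b → lam a b < q ∧ h a (lam a b) ≠ h b (lam a b))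
    (hmu : ∀ a b, a ≠ b → h a (mu a b) ≠ h b (mu a b))
    (hlm : ∀ a b c, a ≠ b → b ≠ c → mu b c ≤ lam a b)
    (w : ℕ → Fin 3) (N : ℕ) (hw : SF N w) (i p : ℕ) (hp : q + l ≤ p + 1)
    (hN : i + 2 * p ≤ q * N)
    (hsq : ∀ k < p, img q h w (i + k) = img q h w (i + p + k)) : False := by
  have hq0 : 0 < q := by omega
  have hdvd : q ∣ p := by
    obtain ⟨s, hs1, hs2, hs3⟩ : ∃ s, i ≤ q * s + ρ ∧ q * s + ρ < i + q ∧ True := by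
      have e := Nat.div_add_mod i q
      have e2 := Nat.mod_lt i hq0
      by_cases hc : i % q ≤ ρ
      · exact ⟨i / q, by omega, by omega, trivial⟩
      · exact ⟨i / q + 1, by rw [mul_add]; omega, by rw [mul_add]; omega, trivial⟩
    have e := Nat.div_add_mod (q * s + ρ + p) q
    have e2 := Nat.mod_lt (q * s + ρ + p) hq0
    have := hS (w s) (w ((q * s + ρ + p) / q)) (w ((q * s + ρ + p) / q + 1))
      ((q * s + ρ + p) % q) e2 (by
        intro t ht
        rw [← img_pair (q := q) h w _ ((q * s + ρ + p) % q + t) (by omega),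
          ← img_eq (q := q) h w s (ρ + t) (by omega)]
        have := hsq (q * s + ρ + t - i) (by omega)
        rw [show i + (q * s + ρ + t - i) = q * s + (ρ + t) by omega,
          show i + p + (q * s + ρ + t - i) = q * ((q * s + ρ + p) / q) +
            ((q * s + ρ + p) % q + t) by omega] at this
        exact this)
    rw [this] at e
    have e3 : p + q * s = q * ((q * s + ρ + p) / q) := by omega
    exact (Nat.dvd_add_left (Dvd.intro s rfl)).1 ⟨_, e3⟩
  obtain ⟨m, rfl⟩ := hdvd
  have hm : 1 ≤ m := by
    rcases Nat.eq_zero_or_pos m with rfl | h'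
    · omega
    · exact h'
  obtain ⟨j, r, hr, rfl⟩ : ∃ j r, r < q ∧ i = q * j + r :=
    ⟨i / q, i % q, Nat.mod_lt _ hq0, (Nat.div_add_mod i q).symm⟩
  have hblock : ∀ n t, t < q → q * j + r ≤ q * n + t → q * n + t < q * j + r + q * m →
      h (w n) t = h (w (n + m)) t := by
    intro n t ht h1 h2
    have := hsq (q * n + t - (q * j + r)) (by omega)
    rw [show q * j + r + (q * n + t - (q * j + r)) = q * n + t by omega,
      show q * j + r + q * m + (q * n + t - (q * j + r)) = q * (n + m) + t by
        rw [mul_add]; omega, img_eq h w _ _ ht, img_eq h w _ _ ht] at this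
    exact this
  have hfull : ∀ n, j < n → n < j + m → w n = w (n + m) := by
    intro n h1 h2
    by_contra hne
    obtain ⟨g1, g2⟩ := hlam _ _ hne
    refine g2 (hblock n _ g1 ?_ ?_)
    · have := Nat.mul_le_mul_left q (show j + 1 ≤ n from h1)
      rw [mul_add] at this; omega
    · have := Nat.mul_le_mul_left q (show n + 1 ≤ j + m from h2)
      rw [mul_add, mul_add] at this; omega
  have hNb : j + 2 * m ≤ N := by
    have : q * (j + 2 * m) ≤ q * N := by
      rw [mul_add, mul_left_comm]; omega
    exact Nat.le_of_mul_le_mul_left this hq0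
  by_cases hab : w j = w (j + m)
  · refine hw j m hm hNb ?_
    intro k hk
    rcases Nat.eq_zero_or_pos k with rfl | hk0
    · simpa using hab
    · rw [hfull (j + k) (by omega) (by omega)]; congr 1; omega
  · obtain ⟨g1, g2⟩ := hlam _ _ hab
    by_cases hrl : r ≤ lam (w j) (w (j + m))
    · exact g2 (hblock j _ g1 (by omega) (by have := Nat.mul_le_mul_left q hm; omega))
    · have hNb2 : j + 2 * m + 1 ≤ N := by
        have : q * (j + 2 * m) < q * N := by
          rw [mul_add, mul_left_comm]; omega
        exact Nat.lt_of_mul_lt_mul_left this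
      by_cases hbc : w (j + m) = w (j + m + m)
      · refine hw (j + 1) m hm (by omega) ?_
        intro k hk
        by_cases hkm : k + 1 = m
        · rw [show j + 1 + k = j + m by omega, hbc]; congr 1; omega
        · rw [hfull (j + 1 + k) (by omega) (by omega)]; congr 1; omega
      · have g3 := hlm _ _ _ hab hbc
        refine hmu _ _ hbc (hblock (j + m) _ (by omega) ?_ ?_)
        · have := Nat.mul_le_mul_left q hm
          rw [mul_add]; omega
        · rw [mul_add]; omega

/-! ### Square-free ternary words (the Leech morphism) -/

/-- The square-free Leech morphism. -/
def leechL : Fin 3 → List (Fin 3)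
  | 0 => [0, 1, 2, 1, 0, 2, 1, 2, 0, 1, 2, 1, 0]
  | 1 => [1, 2, 0, 2, 1, 0, 2, 0, 1, 2, 0, 2, 1]
  | 2 => [2, 0, 1, 0, 2, 1, 0, 1, 2, 0, 1, 0, 2]

/-- The Leech morphism, letter by letter. -/
def leech (a : Fin 3) (n : ℕ) : Fin 3 := (leechL a).getD n 0

lemma SF.ne {α : Type} {N : ℕ} {w : ℕ → α} (hw : SF N w) (i : ℕ) (h : i + 2 ≤ N) :
    w i ≠ w (i + 1) := by
  intro he
  refine hw i 1 le_rfl (by omega) fun k hk => ?_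
  obtain rfl : k = 0 := by omega
  simpa using he

lemma SF.ne2 {α : Type} {N : ℕ} {w : ℕ → α} (hw : SF N w) (i : ℕ) (h : i + 4 ≤ N) :
    ¬ (w i = w (i + 2) ∧ w (i + 1) = w (i + 3)) := by
  rintro ⟨h1, h2⟩
  refine hw i 2 (by omega) (by omega) fun k hk => ?_
  interval_cases k
  · simpa using h1
  · simpa using h2

/-- Window of five blocks. -/
def five (a b c d e : Fin 3) (n : ℕ) : Fin 3 :=
  leech (match n / 13 with | 0 => a | 1 => b | 2 => c | 3 => d | _ => e) (n % 13)

lemma img_five (w : ℕ → Fin 3) (j n : ℕ) (hn : n < 65) :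
    img 13 leech w (13 * j + n) =
      five (w j) (w (j + 1)) (w (j + 2)) (w (j + 3)) (w (j + 4)) n := by
  unfold img five
  rw [show (13 * j + n) / 13 = j + n / 13 by omega, show (13 * j + n) % 13 = n % 13 by omega]
  have : n / 13 < 5 := by omega
  interval_cases n / 13 <;> rfl

lemma leech_sync : ∀ a b c : Fin 3, ∀ k < 13,
    (∀ t < 13, leech a (0 + t) = pair 13 leech b c (k + t)) → k = 0 := by
  decide +kernel

lemma leech_small : ∀ a b c d e : Fin 3, a ≠ b → b ≠ c → c ≠ d → d ≠ e →
    ¬ (a = c ∧ b = d) → ¬ (b = d ∧ c = e) → ∀ r < 13, ∀ p < 26, 1 ≤ p →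
    ¬ ∀ k < p, five a b c d e (r + k) = five a b c d e (r + p + k) := by
  decide +kernel

lemma leech_SF (N : ℕ) (w : ℕ → Fin 3) (hw : SF N w) : SF (13 * (N - 4)) (img 13 leech w) := by
  intro i p hp hN hsq
  by_cases hlong : 26 ≤ p + 1
  · refine long_square 13 13 0 leech (fun _ _ => 12) (fun _ _ => 0) (by omega) (by omega)
      (fun a b c k hk h => leech_sync a b c k hk h) (by decide) (by decide) (by simp) w N hw i p
      (by omega) (by omega) hsq
  · have hj : i / 13 + 5 ≤ N := by omega
    refine leech_small _ _ _ _ _ (hw.ne (i / 13) (by omega)) (hw.ne (i / 13 + 1) (by omega))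
      (hw.ne (i / 13 + 2) (by omega)) (hw.ne (i / 13 + 3) (by omega))
      (hw.ne2 (i / 13) (by omega)) (hw.ne2 (i / 13 + 1) (by omega)) (i % 13)
      (Nat.mod_lt _ (by omega)) p (by omega) hp ?_
    intro k hk
    have := hsq k hk
    rw [show i + k = 13 * (i / 13) + (i % 13 + k) by omega,
      show i + p + k = 13 * (i / 13) + (i % 13 + p + k) by omega,
      img_five _ _ _ (by omega), img_five _ _ _ (by omega)] at this
    exact this

lemma exists_SF (N : ℕ) : ∃ w : ℕ → Fin 3, SF N w := by
  have key : ∀ n : ℕ, ∃ w : ℕ → Fin 3, SF (n + 5) w := by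
    intro n
    induction n with
    | zero =>
      refine ⟨fun n => [0, 1, 0, 2, 0].getD n 0, ?_⟩
      have : ∀ i < 5, ∀ p < 5, 1 ≤ p → i + 2 * p ≤ 5 →
          ¬ ∀ k < p, ([0, 1, 0, 2, 0] : List (Fin 3)).getD (i + k) 0 =
            [0, 1, 0, 2, 0].getD (i + p + k) 0 := by decide
      intro i p hp hN
      exact this i (by omega) p (by omega) hp (by omega)
    | succ n ih =>
      obtain ⟨w, hw⟩ := ih
      refine ⟨_, fun i p hp hN => leech_SF _ w hw i p hp (by omega)⟩
  obtain ⟨w, hw⟩ := key N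
  exact ⟨w, fun i p hp hN => hw i p hp (by omega)⟩

/-! ### The words with few squares -/

/-- The three blocks of length 374, as numbers (lowest bit first). -/
def hN : Fin 3 → ℕ
  | 0 => 13501389327122446633572657353790925977456589585109365114110956208451006060309268609591899172309841201627823432524
  | 1 => 13501389327122446633572657353790925977456589585109365114110956208451006060309268609591899172312147044637037126476
  | 2 => 13501389327122446633572657353790925977004276736526098725737632048260818920257432731991740719033016983006033306444

/-- The 374-uniform binary morphism. -/
def hb (a : Fin 3) (n : ℕ) : Bool := (hN a).testBit n

/-- Last position where two blocks differ. -/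
def lamb (a b : Fin 3) : ℕ := if a = 2 ∨ b = 2 then 248 else 61

/-- First position where two blocks differ. -/
def mub (a b : Fin 3) : ℕ := if a = 2 ∨ b = 2 then 50 else 61

/-- Boolean check of synchronization. -/
def syncB (a b c : Fin 3) : Bool :=
  (List.range 374).all fun k => (k == 129) ||
    (List.range 41).any fun t => hb a (129 + t) != pair 374 hb b c (k + t)

lemma syncB_ok : ∀ a b c : Fin 3, syncB a b c = true := by
  decide +kernel

lemma hb_sync (a b c : Fin 3) (k : ℕ) (hk : k < 374)
    (h : ∀ t < 41, hb a (129 + t) = pair 374 hb b c (k + t)) : k = 129 := by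
  have := List.all_eq_true.1 (syncB_ok a b c) k (by simpa using hk)
  simp only [Bool.or_eq_true, beq_iff_eq, List.any_eq_true, List.mem_range, bne_iff_ne] at this
  rcases this with h1 | ⟨t, h1, h2⟩
  · exact h1
  · exact absurd (h t h1) h2

/-- Evaluate the first argument before passing it on. -/
def forceN (n : ℕ) (F : ℕ → ℕ) : ℕ :=
  match n with
  | 0 => F 0
  | k + 1 => F (k + 1)

lemma forceN_eq (n : ℕ) (F : ℕ → ℕ) : forceN n F = F n := by cases n <;> rfl

/-- Or of all shifts of `z` by doubling: windows of length `cur` become windows of length `p`. -/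
def orf : ℕ → ℕ → ℕ → ℕ → ℕ
  | 0, _, _, z => z
  | f + 1, cur, p, z =>
    match Nat.ble (2 * cur) p with
    | true => forceN (z ||| (z >>> cur)) fun z' => orf f (2 * cur) p z'
    | false => z ||| (z >>> (p - cur))

lemma orf_spec (y p f cur z : ℕ) (h1 : cur ≤ p)
    (hz : ∀ r, z.testBit r = true → ∃ k < cur, y.testBit (r + k) = true) (r : ℕ)
    (hr : (orf f cur p z).testBit r = true) : ∃ k < p, y.testBit (r + k) = true := by
  induction f generalizing cur z with
  | zero =>
    obtain ⟨k, hk, h⟩ := hz r hr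
    exact ⟨k, by omega, h⟩
  | succ f ih =>
    unfold orf at hr
    split at hr
    · rename_i hc
      rw [forceN_eq] at hr
      refine ih (2 * cur) _ (by simpa using hc) ?_ hr
      intro r hr
      rw [Nat.testBit_or, Bool.or_eq_true, Nat.testBit_shiftRight] at hr
      rcases hr with hr | hr
      · obtain ⟨k, hk, h⟩ := hz r hr
        exact ⟨k, by omega, h⟩
      · obtain ⟨k, hk, h⟩ := hz _ hr
        exact ⟨cur + k, by omega, by rw [← h]; congr 1; omega⟩
    · rw [Nat.testBit_or, Bool.or_eq_true, Nat.testBit_shiftRight] at hr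
      rcases hr with hr | hr
      · obtain ⟨k, hk, h⟩ := hz r hr
        exact ⟨k, by omega, h⟩
      · obtain ⟨k, hk, h⟩ := hz _ hr
        exact ⟨p - cur + k, by omega, by rw [← h]; congr 1; omega⟩

/-- No square of period `p` starts at the first 374 positions of `M`. -/
def noSq (M p : ℕ) : Bool :=
  Nat.beq (forceN (M ^^^ (M >>> p)) (fun y => orf 10 1 p y) % 2 ^ 374) (2 ^ 374 - 1)

lemma noSq_spec (M p r : ℕ) (hp : 1 ≤ p) (h : noSq M p = true) (hr : r < 374) :
    ∃ k < p, M.testBit (r + k) ≠ M.testBit (r + p + k) := by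
  rw [noSq, forceN_eq, Nat.beq_eq] at h
  have hbit := congrArg (fun x : ℕ => x.testBit r) h
  simp only [Nat.testBit_mod_two_pow, Nat.testBit_two_pow_sub_one, hr, decide_true,
    Bool.true_and] at hbit
  obtain ⟨k, hk, h⟩ := orf_spec (M ^^^ (M >>> p)) p 10 1 _ hp
    (fun r hr => ⟨0, by omega, by simpa using hr⟩) r hbit
  refine ⟨k, hk, ?_⟩
  rw [Nat.testBit_xor, Nat.testBit_shiftRight] at h
  rw [show r + p + k = p + (r + k) by omega]
  simpa using h

/-- Four consecutive blocks. -/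
def four (a b c d : Fin 3) : ℕ :=
  hN a ||| (hN b <<< 374) ||| (hN c <<< 748) ||| (hN d <<< 1122)

lemma hN_lt (a : Fin 3) (n : ℕ) (hn : 374 ≤ n) : (hN a).testBit n = false := by
  apply Nat.testBit_lt_two_pow
  have : ∀ a, hN a < 2 ^ 374 := by decide +kernel
  exact (this a).trans_le (Nat.pow_le_pow_right (by omega) hn)

lemma img_four (w : ℕ → Fin 3) (j n : ℕ) (hn : n < 1496) :
    img 374 hb w (374 * j + n) =
      (four (w j) (w (j + 1)) (w (j + 2)) (w (j + 3))).testBit n := by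
  unfold img four hb
  rw [show (374 * j + n) / 374 = j + n / 374 by omega,
    show (374 * j + n) % 374 = n % 374 by omega]
  simp only [Nat.testBit_or, Nat.testBit_shiftLeft]
  rcases lt_or_ge n 374 with h1 | h1
  · rw [show n / 374 = 0 by omega, show n % 374 = n by omega]
    simp [show ¬ 374 ≤ n by omega, show ¬ 748 ≤ n by omega, show ¬ 1122 ≤ n by omega]
  rcases lt_or_ge n 748 with h2 | h2
  · rw [show n / 374 = 1 by omega, show n % 374 = n - 374 by omega, hN_lt _ n (by omega)]
    simp [show 374 ≤ n by omega, show ¬ 748 ≤ n by omega, show ¬ 1122 ≤ n by omega]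
  rcases lt_or_ge n 1122 with h3 | h3
  · rw [show n / 374 = 2 by omega, show n % 374 = n - 748 by omega, hN_lt _ n (by omega),
      hN_lt _ (n - 374) (by omega)]
    simp [show 748 ≤ n by omega, show ¬ 1122 ≤ n by omega]
  · rw [show n / 374 = 3 by omega, show n % 374 = n - 1122 by omega, hN_lt _ n (by omega),
      hN_lt _ (n - 374) (by omega), hN_lt _ (n - 748) (by omega)]
    simp [show 1122 ≤ n by omega]

/-- No square of period between 3 and 413 starts in the first of four blocks. -/
def smallB (a b c d : Fin 3) : Bool :=
  force (four a b c d) fun M => (List.range 411).all fun t => noSq M (t + 3)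

lemma smallB_ok : ∀ a b c d : Fin 3, a ≠ b → b ≠ c → c ≠ d → ¬ (a = c ∧ b = d) →
    smallB a b c d = true := by
  decide +kernel

lemma img_squares (N : ℕ) (w : ℕ → Fin 3) (hw : SF (N + 4) w) (i p : ℕ) (hp : 3 ≤ p)
    (hi : i + 2 * p ≤ 374 * N)
    (hsq : ∀ k < p, img 374 hb w (i + k) = img 374 hb w (i + p + k)) : False := by
  by_cases hlong : 374 + 41 ≤ p + 1
  · refine long_square 374 41 129 hb lamb mub (by omega) (by omega) hb_sync
      (by decide +kernel) (by decide +kernel) (by decide) w (N + 4) hw i p hlong (by omega) hsq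
  · have h := smallB_ok _ _ _ _ (hw.ne (i / 374) (by omega)) (hw.ne (i / 374 + 1) (by omega))
      (hw.ne (i / 374 + 2) (by omega)) (hw.ne2 (i / 374) (by omega))
    rw [smallB, force_eq, List.all_eq_true] at h
    have h2 := h (p - 3) (by rw [List.mem_range]; omega)
    rw [show p - 3 + 3 = p by omega] at h2
    obtain ⟨k, hk, hne⟩ := noSq_spec _ p (i % 374) (by omega) h2 (Nat.mod_lt _ (by omega))
    rw [← img_four _ _ _ (by omega), ← img_four _ _ _ (by omega)] at hne
    apply hne
    have := hsq k hk
    rw [show i + k = 374 * (i / 374) + (i % 374 + k) by omega,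
      show i + p + k = 374 * (i / 374) + (i % 374 + p + k) by omega] at this
    exact this

/-- Squares of period 1 and 2 starting at position `i`. -/
def loc (W : ℕ → Bool) (i : ℕ) : ℕ :=
  (if W i = W (i + 1) then 1 else 0) +
    (if W i = W (i + 2) ∧ W (i + 1) = W (i + 3) then 1 else 0)

lemma loc_block : ∀ b c : Fin 3, b ≠ c →
    ∑ r ∈ Finset.range 374, loc (pair 374 hb b c) r ≤ 206 := by
  decide +kernel

lemma loc_sum (w : ℕ → Fin 3) (J : ℕ) (hw : SF (J + 1) w) :
    ∑ i ∈ Finset.range (374 * J), loc (img 374 hb w) i ≤ 206 * J := by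
  induction J with
  | zero => simp
  | succ J ih =>
    have ih := ih (fun i p hp hN => hw i p hp (by omega))
    rw [show 374 * (J + 1) = 374 * J + 374 by ring, Finset.sum_range_add]
    have h2 := loc_block _ _ (hw.ne J (by omega))
    have h3 : ∑ r ∈ Finset.range 374, loc (img 374 hb w) (374 * J + r) =
        ∑ r ∈ Finset.range 374, loc (pair 374 hb (w J) (w (J + 1))) r := by
      refine Finset.sum_congr rfl fun r hr => ?_
      rw [Finset.mem_range] at hr
      simp only [loc, add_assoc]
      rw [img_pair hb w J r (by omega), img_pair hb w J (r + 1) (by omega),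
        img_pair hb w J (r + 2) (by omega), img_pair hb w J (r + 3) (by omega)]
    omega

lemma upper_bound (n : ℕ) : ∃ u : List Bool, u.length = n ∧
    187 * (squareOccs u).ncard ≤ 103 * n + 38522 := by
  classical
  obtain ⟨w, hw⟩ := exists_SF (n / 374 + 1 + 4)
  set W := img 374 hb w with hW
  refine ⟨(List.range n).map W, by simp, ?_⟩
  set A : Finset ℕ := (Finset.range n).filter (fun i => W i = W (i + 1)) with hA
  set B : Finset ℕ :=
    (Finset.range n).filter (fun i => W i = W (i + 2) ∧ W (i + 1) = W (i + 3)) with hB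
  have hsub : squareOccs ((List.range n).map W) ⊆
      ((A.image (fun i => (i, 1)) ∪ B.image (fun i => (i, 2)) : Finset (ℕ × ℕ)) :
        Set (ℕ × ℕ)) := by
    rintro ⟨i, p⟩ h
    rw [mem_squareOccs] at h
    obtain ⟨h1, h2, h3⟩ := h
    simp only [List.length_map, List.length_range] at h2
    have h4 : ∀ k < p, W (i + k) = W (i + p + k) := by
      intro k hk
      have := h3 k hk
      simpa [List.getElem?_map, List.getElem?_range, show i + k < n by omega,
        show i + p + k < n by omega] using this
    have h5 : p < 3 := by
      by_contra hc
      exact img_squares (n / 374 + 1) w hw i p (by omega) (by omega) h4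
    simp only [Finset.coe_union, Finset.coe_image, Set.mem_union, Set.mem_image, Finset.mem_coe,
      hA, hB, Finset.mem_filter, Finset.mem_range, Prod.mk.injEq]
    interval_cases p
    · left
      exact ⟨i, ⟨by omega, by simpa using h4 0 (by omega)⟩, rfl, rfl⟩
    · right
      refine ⟨i, ⟨by omega, by simpa using h4 0 (by omega), ?_⟩, rfl, rfl⟩
      simpa [add_assoc] using h4 1 (by omega)
  have hcard : (squareOccs ((List.range n).map W)).ncard ≤ A.card + B.card := by
    refine (Set.ncard_le_ncard hsub (Finset.finite_toSet _)).trans ?_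
    rw [Set.ncard_coe_finset]
    exact (Finset.card_union_le _ _).trans (Nat.add_le_add Finset.card_image_le
      Finset.card_image_le)
  have hAB : A.card + B.card = ∑ i ∈ Finset.range n, loc W i := by
    simp only [loc, Finset.sum_add_distrib, hA, hB, Finset.card_filter]
  have hle : ∑ i ∈ Finset.range n, loc W i ≤
      ∑ i ∈ Finset.range (374 * (n / 374 + 1)), loc W i := by
    apply Finset.sum_le_sum_of_subset
    apply Finset.range_mono
    omega
  have := loc_sum w (n / 374 + 1) (fun i p hp hN => hw i p hp (by omega))
  rw [← hW] at this
  omega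

/-! ### Conclusion -/

lemma min_spec (n : ℕ) : ∃ w : List Bool, w.length = n ∧
    (squareOccs w).ncard = minSquareOccs n :=
  Nat.sInf_mem (s := {m : ℕ | ∃ w : List Bool, w.length = n ∧ (squareOccs w).ncard = m})
    ⟨_, List.replicate n true, by simp, rfl⟩

lemma min_lower (n : ℕ) : 103 * n ≤ 187 * minSquareOccs n + 487 := by
  obtain ⟨w, rfl, h⟩ := min_spec n
  rw [← h]
  exact lower_bound w

lemma min_upper (n : ℕ) : 187 * minSquareOccs n ≤ 103 * n + 38522 := by
  obtain ⟨u, h1, h2⟩ := upper_bound n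
  have : minSquareOccs n ≤ (squareOccs u).ncard := Nat.sInf_le ⟨u, h1, rfl⟩
  omega

lemma tendsto_min : Filter.Tendsto (fun n : ℕ => (minSquareOccs n : ℝ) / n)
    Filter.atTop (nhds (103 / 187)) := by
  have hlim : ∀ C : ℝ, Filter.Tendsto (fun n : ℕ => (103 / 187 : ℝ) + C / n)
      Filter.atTop (nhds (103 / 187)) := by
    intro C
    simpa using (tendsto_const_div_atTop_nhds_zero_nat C).const_add (103 / 187 : ℝ)
  refine tendsto_of_tendsto_of_tendsto_of_le_of_le' (hlim (-487)) (hlim 38522) ?_ ?_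
  · filter_upwards [Filter.eventually_gt_atTop 0] with n hn
    have hn' : (0 : ℝ) < n := by exact_mod_cast hn
    have h : (103 * n : ℝ) ≤ 187 * minSquareOccs n + 487 := by exact_mod_cast min_lower n
    rw [le_div_iff₀ hn', add_mul, div_mul_cancel₀ _ hn'.ne']
    linarith
  · filter_upwards [Filter.eventually_gt_atTop 0] with n hn
    have hn' : (0 : ℝ) < n := by exact_mod_cast hn
    have h : (187 * minSquareOccs n : ℝ) ≤ 103 * n + 38522 := by exact_mod_cast min_upper n
    rw [div_le_iff₀ hn', add_mul, div_mul_cancel₀ _ hn'.ne']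
    linarith

end SqDens

/-- Kucherov–Ochem–Rao: the sequence `m(n)/n` converges to a limit `𝓜`
satisfying `0.5508 < 𝓜 ≤ 103/187`. -/
theorem minSquareOccs_density_bounds :
    ∃ L : ℝ, Filter.Tendsto (fun n : ℕ => (minSquareOccs n : ℝ) / n)
      Filter.atTop (nhds L) ∧ 0.5508 < L ∧ L ≤ 103 / 187 :=
  ⟨103 / 187, SqDens.tendsto_min, by norm_num, le_rfl⟩
end

section
/- For every n ≥ 1 there exists a binary circular word of length n that is cube-free; that is, there exists a binary word w of length n such that no factor of ww of length at most n is a cube xxx with x nonempty (Currie–Fitzpatrick). -/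
namespace CF

/-- `f` has a cube of period `p` at position `i`. -/
def CubeAt (f : ℕ → Bool) (p i : ℕ) : Prop := ∀ t < 2 * p, f (i + t) = f (i + t + p)

/-- there is a periodic sequence of period `n` without cubes of length at most `n`. -/
def Good (n : ℕ) : Prop :=
  ∃ f : ℕ → Bool, (∀ i, f (i + n) = f i) ∧ ∀ p i, 0 < p → 3 * p ≤ n → ¬ CubeAt f p i

def block : Bool → Bool → List Bool
  | false, false => [false, true, false, true, true, false, true, true, false]
  | false, true => [false, true, false, true, true, false, false, true, true, false]
  | true, false => [false, true, false, false, true, true, false, true, true]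
  | true, true => [false, true, false, false, true, true, false, false, true, true]

def blen (e : Bool) : ℕ := if e then 10 else 9

theorem block_length (x e : Bool) : (block x e).length = blen e := by
  cases x <;> cases e <;> rfl

def win (x0 e0 x1 e1 x2 e2 x3 e3 : Bool) : List Bool :=
  block x0 e0 ++ (block x1 e1 ++ (block x2 e2 ++ block x3 e3))

def cubeB (L : List Bool) (p i : ℕ) : Bool :=
  (List.range (2 * p)).all fun t => L.getD (i + t) false == L.getD (i + t + p) false

theorem small_check : ∀ x0 e0 x1 e1 x2 e2 x3 e3 : Bool,
    ((List.range 10).all fun i => (List.range 8).all fun p =>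
      !cubeB (win x0 e0 x1 e1 x2 e2 x3 e3) (p + 1) i) = true := by
  decide +kernel

theorem sync_check : ∀ x0 e0 x1 e1 : Bool,
    ((List.range (blen e0)).all fun i => i == 0 ||
      ((win x0 e0 x1 e1 false false false false).getD i false ||
       !(win x0 e0 x1 e1 false false false false).getD (i + 1) false ||
       (win x0 e0 x1 e1 false false false false).getD (i + 2) false)) = true := by
  decide +kernel

/-- The core desubstitution argument. -/
theorem core (f w : ℕ → Bool) (S : ℕ → ℕ) (m n : ℕ)
    (hS0 : S 0 = 0) (h1 : ∀ j, S j + 9 ≤ S (j + 1)) (h2 : ∀ j, S (j + 1) ≤ S j + 10)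
    (hper : ∀ j, S (j + m) = S j + n)
    (hF : ∀ j, f (S j) = false ∧ f (S j + 1) = true ∧ f (S j + 2) = false)
    (hsync : ∀ q, f q = false → f (q + 1) = true → f (q + 2) = false → ∃ j, q = S j)
    (hc : ∀ j, f (S j + 3) = !w j) (hl : ∀ j, f (S (j + 1) - 1) = w j)
    (hsmall : ∀ p i, 0 < p → p < 9 → ¬ CubeAt f p i)
    (hw : ∀ p i, 0 < p → 3 * p ≤ m → ¬ CubeAt w p i) :
    ∀ p i, 0 < p → 3 * p ≤ n → ¬ CubeAt f p i := by
  intro p i hp hpn hcube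
  have hp9 : 9 ≤ p := by
    by_contra h
    exact hsmall p i hp (by omega) hcube
  have hmono : StrictMono S := strictMono_nat_of_lt_succ fun j => by have := h1 j; omega
  have fw : ∀ q, i ≤ q → q < i + 2 * p → f q = f (q + p) := by
    intro q hq1 hq2
    have := hcube (q - i) (by omega)
    rwa [show i + (q - i) = q by omega] at this
  -- forward and backward synchronisation
  have up : ∀ u, i ≤ S u → S u + 3 ≤ i + 2 * p → ∃ v, S v = S u + p := by
    intro u hu1 hu2
    obtain ⟨a, b, c⟩ := hF u
    obtain ⟨v, hv⟩ := hsync (S u + p) (by rw [← fw _ hu1 (by omega)]; exact a)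
      (by rw [show S u + p + 1 = S u + 1 + p by omega, ← fw _ (by omega) (by omega)]; exact b)
      (by rw [show S u + p + 2 = S u + 2 + p by omega, ← fw _ (by omega) (by omega)]; exact c)
    exact ⟨v, hv.symm⟩
  have down : ∀ u q, S u = q + p → i ≤ q → q + 3 ≤ i + 2 * p → ∃ v, S v = q := by
    intro u q hu hu1 hu2
    obtain ⟨a, b, c⟩ := hF u
    rw [hu] at a b c
    obtain ⟨v, hv⟩ := hsync q (by rw [fw _ hu1 (by omega)]; exact a)
      (by rw [fw _ (by omega) (by omega), show q + 1 + p = q + p + 1 by omega]; exact b)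
      (by rw [fw _ (by omega) (by omega), show q + 2 + p = q + p + 2 by omega]; exact c)
    exact ⟨v, hv.symm⟩
  have step : ∀ u v, S v = S u + p → i ≤ S u → S (u + 1) + 3 ≤ i + 2 * p →
      S (v + 1) = S (u + 1) + p := by
    intro u v huv hu1 hu2
    have a1 := h1 u
    have a2 := h1 v
    obtain ⟨v', hv'⟩ := up (u + 1) (by omega) hu2
    have : v < v' := hmono.lt_iff_lt.1 (by omega)
    have le1 : S (v + 1) ≤ S v' := hmono.monotone (by omega)
    obtain ⟨u', hu'⟩ := down (v + 1) (S (v + 1) - p) (by omega) (by omega) (by omega)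
    have : u < u' := hmono.lt_iff_lt.1 (by omega)
    have le2 : S (u + 1) ≤ S u' := hmono.monotone (by omega)
    omega
  -- first boundary after `i`
  obtain ⟨k, hk1, hk2⟩ : ∃ k, S k ≤ i ∧ i < S (k + 1) := by
    have hex : ∃ j, i < S j := ⟨i + 1, lt_of_lt_of_le (Nat.lt_succ_self i) (hmono.le_apply)⟩
    classical
    have hne : Nat.find hex ≠ 0 := by
      intro h0
      have := Nat.find_spec hex
      rw [h0, hS0] at this
      omega
    refine ⟨Nat.find hex - 1, ?_, ?_⟩
    · have := Nat.find_min hex (m := Nat.find hex - 1) (by omega)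
      omega
    · rw [show Nat.find hex - 1 + 1 = Nat.find hex by omega]
      exact Nat.find_spec hex
  have k1 := h1 k
  have k2 := h2 k
  obtain ⟨v, hv⟩ := up (k + 1) (by omega) (by omega)
  have hkv : k + 1 < v := hmono.lt_iff_lt.1 (by omega)
  obtain ⟨d, rfl⟩ : ∃ d, v = k + 1 + d := ⟨v - (k + 1), by omega⟩
  have hd : 0 < d := by omega
  -- chain
  have chain : ∀ t, (S (k + 1 + t) + 3 ≤ i + 2 * p) → S (k + 1 + t + d) = S (k + 1 + t) + p := by
    intro t
    induction t with
    | zero => intro _; exact hv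
    | succ t ih =>
      intro ht
      have b1 := h1 (k + 1 + t)
      have e := ih (by rw [← add_assoc] at ht; omega)
      have := step _ _ e (by have := hmono.monotone (show k + 1 ≤ k + 1 + t by omega); omega) ht
      rw [show k + 1 + (t + 1) + d = k + 1 + t + d + 1 by omega, this]
      rfl
  have hlt : ∀ t, t + 2 ≤ 2 * d → S (k + 1 + t) + 4 ≤ i + 2 * p ∧ S (k + 1 + t) < S k + 2 * p := by
    intro t ht
    rcases Nat.lt_or_ge d 2 with h | h
    · obtain rfl : t = 0 := by omega
      simp only [add_zero]; constructor <;> omega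
    · have q1 := h1 (k + 1)
      have q2 := h1 (k + 1 + 1)
      have q3 := hmono.monotone (show k + 1 + 1 + 1 ≤ k + 1 + d by omega)
      have e := chain d (by omega)
      have q4 := h1 (k + 1 + t)
      have q5 := h1 (k + 1 + t + 1)
      have q6 := hmono.monotone (show k + 1 + t + 1 + 1 ≤ k + 1 + d + d by omega)
      constructor <;> omega
  have hcw : CubeAt w d k := by
    intro t ht
    rcases Nat.eq_zero_or_pos t with rfl | h0
    · have e1 := hl k
      have e2 := hl (k + d)
      rw [show k + d + 1 = k + 1 + d by omega, hv,
        show S (k + 1) + p - 1 = S (k + 1) - 1 + p by omega,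
        ← fw _ (by omega) (by omega), e1] at e2
      simpa using e2
    · obtain ⟨t, rfl⟩ : ∃ s, t = s + 1 := ⟨t - 1, by omega⟩
      have g := hlt t (by omega)
      have e := chain t (by omega)
      have e1 := hc (k + 1 + t)
      have e2 := hc (k + 1 + t + d)
      rw [e, show S (k + 1 + t) + p + 3 = S (k + 1 + t) + 3 + p by omega,
        ← fw _ (by have := hmono.monotone (show k + 1 ≤ k + 1 + t by omega); omega) (by omega),
        e1] at e2
      have e3 : w (k + 1 + t) = w (k + 1 + t + d) := by
        revert e2; cases w (k + 1 + t) <;> cases w (k + 1 + t + d) <;> simp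
      rw [show k + (t + 1) = k + 1 + t by omega]
      exact e3
  refine hw d k hd ?_ hcw
  have g := hlt (2 * d - 2) (by omega)
  have e := chain (2 * d - 2) (by omega)
  have hm := hper k
  have : S (k + 1 + (2 * d - 2) + d) < S (k + m) := by omega
  have := hmono.lt_iff_lt.1 this
  omega

/-- boundary positions -/
def pos (e : ℕ → Bool) : ℕ → ℕ
  | 0 => 0
  | j + 1 => pos e j + blen (e j)

theorem exists_pos (e : ℕ → Bool) (i : ℕ) : ∃ j t, t < blen (e j) ∧ i = pos e j + t := by
  induction i with
  | zero => exact ⟨0, 0, by unfold blen; split <;> omega, rfl⟩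
  | succ i ih =>
    obtain ⟨j, t, ht, rfl⟩ := ih
    by_cases h : t + 1 < blen (e j)
    · exact ⟨j, t + 1, h, rfl⟩
    · exact ⟨j + 1, 0, by unfold blen; split <;> omega, by simp only [pos]; omega⟩

theorem pos_unique (e : ℕ → Bool) (j j' t t' : ℕ) (ht : t < blen (e j)) (ht' : t' < blen (e j'))
    (h : pos e j + t = pos e j' + t') : j = j' ∧ t = t' := by
  have hmono : StrictMono (pos e) := strictMono_nat_of_lt_succ fun j => by
    simp only [pos, blen]; split <;> omega
  have : j = j' := by
    rcases lt_trichotomy j j' with h1 | h1 | h1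
    · have := hmono.monotone (show j + 1 ≤ j' by omega)
      simp only [pos] at this; omega
    · exact h1
    · have := hmono.monotone (show j' + 1 ≤ j by omega)
      simp only [pos] at this; omega
  subst this
  exact ⟨rfl, by omega⟩

theorem exists_image (w e : ℕ → Bool) : ∃ f : ℕ → Bool, ∀ j t, t < blen (e j) →
    f (pos e j + t) = (block (w j) (e j)).getD t false := by
  choose J T hT hJ using exists_pos e
  refine ⟨fun i => (block (w (J i)) (e (J i))).getD (T i) false, fun j t ht => ?_⟩
  obtain ⟨a, b⟩ := pos_unique e _ _ _ _ (hT (pos e j + t)) ht (hJ _).symm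
  simp only [a, b]

theorem image_good (w e : ℕ → Bool) (m n : ℕ) (hm : ∀ i, w (i + m) = w i)
    (he : ∀ i, e (i + m) = e i) (hn : pos e m = n)
    (hw : ∀ p i, 0 < p → 3 * p ≤ m → ¬ CubeAt w p i) : Good n := by
  obtain ⟨f, hf⟩ := exists_image w e
  have hper : ∀ j, pos e (j + m) = pos e j + n := by
    intro j
    induction j with
    | zero => simp [pos, hn]
    | succ j ih =>
      rw [show j + 1 + m = j + m + 1 by omega]
      simp only [pos, ih, he]; omega
  have hb9 : ∀ b, 9 ≤ blen b := by decide
  have hb10 : ∀ b, blen b ≤ 10 := by decide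
  have hwin : ∀ j t, t < 36 → f (pos e j + t) = (win (w j) (e j) (w (j+1)) (e (j+1))
      (w (j+2)) (e (j+2)) (w (j+3)) (e (j+3))).getD t false := by
    intro j t ht
    have p1 : pos e (j + 1) = pos e j + blen (e j) := rfl
    have p2 : pos e (j + 2) = pos e (j + 1) + blen (e (j + 1)) := rfl
    have p3 : pos e (j + 3) = pos e (j + 2) + blen (e (j + 2)) := rfl
    have l0 := block_length (w j) (e j)
    have l1 := block_length (w (j+1)) (e (j+1))
    have l2 := block_length (w (j+2)) (e (j+2))
    have l3 := block_length (w (j+3)) (e (j+3))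
    have q0 := hb9 (e j)
    have q1 := hb9 (e (j+1))
    have q2 := hb9 (e (j+2))
    have q3 := hb9 (e (j+3))
    unfold win
    by_cases c0 : t < blen (e j)
    · rw [List.getD_append _ _ _ _ (by omega)]; exact hf _ _ c0
    rw [List.getD_append_right _ _ _ _ (by omega), l0]
    by_cases c1 : t - blen (e j) < blen (e (j+1))
    · rw [List.getD_append _ _ _ _ (by omega), ← hf _ _ c1]; congr 1; omega
    rw [List.getD_append_right _ _ _ _ (by omega), l1]
    by_cases c2 : t - blen (e j) - blen (e (j+1)) < blen (e (j+2))
    · rw [List.getD_append _ _ _ _ (by omega), ← hf _ _ c2]; congr 1; omega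
    rw [List.getD_append_right _ _ _ _ (by omega), l2]
    rw [← hf (j+3) _ (by omega)]; congr 1; omega
  refine ⟨f, ?_, ?_⟩
  · intro i
    obtain ⟨j, t, ht, rfl⟩ := exists_pos e i
    rw [show pos e j + t + n = pos e (j + m) + t by rw [hper]; omega, hf _ _ ht,
      hf _ _ (by rw [he]; exact ht), hm, he]
  refine core f w (pos e) m n rfl (fun j => ?_) (fun j => ?_) hper (fun j => ?_) ?_ (fun j => ?_)
    (fun j => ?_) ?_ hw
  · have := hb9 (e j); simp only [pos]; omega
  · have := hb10 (e j); simp only [pos]; omega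
  · have q0 := hb9 (e j)
    refine ⟨?_, ?_, ?_⟩
    · have := hf j 0 (by omega)
      rw [add_zero] at this
      rw [this]; cases w j <;> cases e j <;> rfl
    · rw [hf j 1 (by omega)]; cases w j <;> cases e j <;> rfl
    · rw [hf j 2 (by omega)]; cases w j <;> cases e j <;> rfl
  · intro q a b c
    obtain ⟨j, t, ht, rfl⟩ := exists_pos e q
    have q1 := hb10 (e j)
    have hs := sync_check (w j) (e j) (w (j+1)) (e (j+1))
    have key : ∀ s < 18, f (pos e j + s) =
        (win (w j) (e j) (w (j+1)) (e (j+1)) false false false false).getD s false := by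
      intro s hs
      rw [hwin j s (by omega)]
      have l0 := block_length (w j) (e j)
      have l1 := block_length (w (j+1)) (e (j+1))
      have q0 := hb9 (e j)
      have q1 := hb9 (e (j+1))
      unfold win
      have aux : ∀ A B C : List Bool, s < (A ++ B).length →
          (A ++ (B ++ C)).getD s false = (A ++ B).getD s false := by
        intro A B C h
        rw [← List.append_assoc, List.getD_append _ _ _ _ h]
      rw [aux _ _ _ (by rw [List.length_append]; omega),
        aux _ _ _ (by rw [List.length_append]; omega)]
    rw [List.all_eq_true] at hs
    have := hs t (List.mem_range.2 ht)
    rw [← key t (by omega), ← key (t+1) (by omega), ← key (t+2) (by omega),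
      ← add_assoc, ← add_assoc, a, b, c] at this
    simp at this
    exact ⟨j, by omega⟩
  · have q0 := hb9 (e j)
    rw [hf j 3 (by omega)]; cases w j <;> cases e j <;> rfl
  · have q0 := hb9 (e j)
    rw [show pos e (j+1) - 1 = pos e j + (blen (e j) - 1) by simp only [pos]; omega,
      hf j _ (by omega)]; cases w j <;> cases e j <;> rfl
  · intro p i hp hp9 hcube
    obtain ⟨j, t, ht, rfl⟩ := exists_pos e i
    have q1 := hb10 (e j)
    have hs := small_check (w j) (e j) (w (j+1)) (e (j+1))
      (w (j+2)) (e (j+2)) (w (j+3)) (e (j+3))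
    rw [List.all_eq_true] at hs
    have hs := hs t (List.mem_range.2 (by omega))
    rw [List.all_eq_true] at hs
    have hs := hs (p - 1) (List.mem_range.2 (by omega))
    rw [show p - 1 + 1 = p by omega] at hs
    rw [Bool.not_eq_true'] at hs
    refine Bool.eq_false_iff.1 hs ?_
    unfold cubeB
    rw [List.all_eq_true]
    intro s hs
    have hs := List.mem_range.1 hs
    have := hcube s hs
    rw [add_assoc, add_assoc, hwin j _ (by omega), hwin j _ (by omega)] at this
    rw [this]; simp

theorem pos_flag (m r : ℕ) : ∀ j ≤ m,
    pos (fun i => decide (i % m < r)) j = 9 * j + min j r := by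
  intro j
  induction j with
  | zero => intro _; simp [pos]
  | succ j ih =>
    intro hj
    simp only [pos, ih (by omega), blen, Nat.mod_eq_of_lt (show j < m by omega), decide_eq_true_eq]
    split <;> omega

theorem good_step (m r : ℕ) (hr : r ≤ m) (h : Good m) : Good (9 * m + r) := by
  obtain ⟨w, hw1, hw2⟩ := h
  refine image_good w (fun i => decide (i % m < r)) m _ hw1 (fun i => by simp) ?_ hw2
  rw [pos_flag m r m le_rfl]; omega

def baseWords : List (ℕ × ℕ) := [(1, 0), (2, 0), (3, 4), (4, 12), (5, 20), (6, 36), (7, 100), (8, 164), (11, 1636), (12, 3236), (13, 6564), (14, 13476), (15, 25764), (16, 51620), (17, 111780), (21, 1729700), (22, 3564708), (23, 6907044), (24, 13788324), (25, 28468388), (26, 55207076), (31, 1691509924), (32, 3662832804), (33, 7286711460), (34, 14400251044), (35, 28761547940), (41, 1809025492132), (42, 3475472802980), (43, 7048885593252), (44, 14470589080740), (51, 1850655007466660), (52, 3820979844441252), (53, 7409785797502116), (61, 1932768995242566820), (62, 3860309635757139108), (71, 1942209589256018617508)]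

def baseCheck (n c : ℕ) : Bool :=
  (List.range (n / 3)).all fun p => (List.range n).all fun i =>
    !((List.range (2 * (p + 1))).all fun t =>
      c.testBit ((i + t) % n) == c.testBit ((i + t + (p + 1)) % n))

theorem base_ok : (baseWords.all fun x => baseCheck x.1 x.2) = true := by decide +kernel

theorem base_cover : ∀ n < 72, n % 9 ≤ n / 9 ∨ ∃ x ∈ baseWords, x.1 = n := by decide +kernel

theorem good_of_check (n c : ℕ) (hn : 0 < n) (h : baseCheck n c = true) : Good n := by
  refine ⟨fun i => c.testBit (i % n), fun i => by simp, fun p i hp hpn hc => ?_⟩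
  unfold baseCheck at h
  rw [List.all_eq_true] at h
  have h := h (p - 1) (List.mem_range.2 (by omega))
  rw [List.all_eq_true] at h
  have h := h (i % n) (List.mem_range.2 (Nat.mod_lt _ hn))
  rw [show p - 1 + 1 = p by omega, Bool.not_eq_true'] at h
  refine Bool.eq_false_iff.1 h ?_
  rw [List.all_eq_true]
  intro t ht
  have := hc t (List.mem_range.1 ht)
  simp only at this
  rw [Nat.mod_add_mod, show i % n + t + p = i % n + (t + p) by omega, Nat.mod_add_mod,
    ← add_assoc, this]
  simp

theorem good_all (n : ℕ) : 1 ≤ n → Good n := by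
  induction n using Nat.strong_induction_on with
  | _ n ih =>
    intro hn
    by_cases h : n % 9 ≤ n / 9
    · have := good_step (n / 9) (n % 9) h (ih (n / 9) (by omega) (by omega))
      rwa [Nat.div_add_mod] at this
    · rcases base_cover n (by omega) with h' | ⟨x, hx, rfl⟩
      · exact absurd h' h
      · exact good_of_check x.1 x.2 hn (List.all_eq_true.1 base_ok x hx)

end CF

theorem exists_cubefree_binary_circular_word (n : ℕ) (hn : 1 ≤ n) :
    ∃ w : List Bool, w.length = n ∧
      ∀ x : List Bool, x ≠ [] → 3 * x.length ≤ n →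
        ¬ (x ++ x ++ x) <:+: (w ++ w) := by
  obtain ⟨f, hf, hc⟩ := CF.good_all n hn
  refine ⟨(List.range n).map f, by simp, ?_⟩
  rintro x hx hxn ⟨s, t, hst⟩
  have hww : (List.range n).map f ++ (List.range n).map f = (List.range (n + n)).map f := by
    rw [List.range_add, List.map_append, List.map_map]
    congr 1
    apply List.map_congr_left
    intro a _
    simp only [Function.comp]
    rw [add_comm, hf]
  rw [hww] at hst
  have hlen := congrArg List.length hst
  simp only [List.length_append, List.length_map, List.length_range] at hlen
  have hget : ∀ q < n + n, (s ++ (x ++ x ++ x) ++ t)[q]? = some (f q) := by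
    intro q hq
    rw [hst]
    simp [hq]
  refine hc x.length s.length (List.length_pos_iff.2 hx) hxn ?_
  intro u hu
  have g1 := hget (s.length + u) (by omega)
  have g2 := hget (s.length + u + x.length) (by omega)
  have : some (f (s.length + u)) = some (f (s.length + u + x.length)) := by
    rw [← g1, ← g2]
    simp only [List.getElem?_append, List.length_append]
    rcases Nat.lt_or_ge u x.length with h | h
    · grind
    · grind
  exact Option.some.inj this
end
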